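/- arXiv:1202.4480 — 4 statements merged into one kernel-verified Lean document; each statement's English description precedes it below -/
import Mathlib

section
/- If X is a Hausdorff topological space, then HM(X) with the Hartman–Mycielski topology is a Hausdorff topological space. -/
open Set MeasureTheory Topology

universe u v

namespace HMPaper

abbrev I01 : Set ℝ := Set.Ico (0:ℝ) 1

def IsStep {X : Type u} (f : I01 → X) : Prop :=
  ∃ (n : ℕ) (a : Fin (n + 1) → ℝ), a 0 = 0 ∧ a (Fin.last n) = 1 ∧ StrictMono a ∧
    ∀ (i : Fin n) (s t : I01), (s : ℝ) ∈ Set.Ico (a i.castSucc) (a i.succ) →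
      (t : ℝ) ∈ Set.Ico (a i.castSucc) (a i.succ) → f s = f t

def HM (X : Type u) : Type u := {f : I01 → X // IsStep f}

theorem isStep_const {X : Type u} (x : X) : IsStep (fun _ : I01 => x) := by
  refine ⟨1, ![0, 1], rfl, rfl, ?_, fun i s t _ _ => rfl⟩
  intro i j hij
  fin_cases i <;> fin_cases j <;> simp_all

def hmConst {X : Type u} (x : X) : HM X := ⟨fun _ => x, isStep_const x⟩

theorem isStep_comp {X : Type u} {Y : Type v} (p : X → Y) {f : I01 → X}
    (hf : IsStep f) : IsStep (fun t => p (f t)) := by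
  obtain ⟨n, a, h0, h1, hm, hc⟩ := hf
  exact ⟨n, a, h0, h1, hm, fun i s t hs ht => congrArg p (hc i s t hs ht)⟩

def hmMap {X : Type u} {Y : Type v} (p : X → Y) (f : HM X) : HM Y :=
  ⟨fun t => p (f.1 t), isStep_comp p f.2⟩

/-- The basic set `N(a,b,V,ε)` of the Hartman–Mycielski topology: all step functions `g`
with `λ {t ∈ [a,b) : g(t) ∉ V} < ε` (`λ` being Lebesgue measure). -/
def hmBasicSet {X : Type u} (a b : ℝ) (V : Set X) (ε : ℝ) : Set (HM X) :=
  {g : HM X | MeasureTheory.volume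
    {t : ℝ | ∃ ht : t ∈ I01, t ∈ Set.Ico a b ∧ g.1 ⟨t, ht⟩ ∉ V} < ENNReal.ofReal ε}

/-- The neighborhood subbase of the Hartman–Mycielski topology at a step function `f`:
all sets `N(a,b,V,ε)` where `0 ≤ a < b ≤ 1`, `f` is constant on `[a,b)`, `V` is a
neighborhood of `f(a)` and `ε > 0`. -/
def hmSubbasis {X : Type u} [TopologicalSpace X] (f : HM X) : Set (Set (HM X)) :=
  {S | ∃ (a b : ℝ) (ha : 0 ≤ a) (hab : a < b) (hb : b ≤ 1) (V : Set X) (ε : ℝ),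
    0 < ε ∧
    (∀ s t : I01, (s : ℝ) ∈ Set.Ico a b → (t : ℝ) ∈ Set.Ico a b → f.1 s = f.1 t) ∧
    V ∈ nhds (f.1 ⟨a, ha, hab.trans_le hb⟩) ∧
    S = hmBasicSet a b V ε}

/-- The Hartman–Mycielski topology on `HM X`: the topology whose neighborhood filter at
each `f` is generated by the neighborhood subbase `hmSubbasis f`. -/
instance hmTopologicalSpace (X : Type u) [TopologicalSpace X] : TopologicalSpace (HM X) :=
  TopologicalSpace.mkOfNhds fun f => Filter.generate (hmSubbasis f)

theorem exists_mem_cell {n : ℕ} (a : Fin (n + 1) → ℝ) (x : ℝ)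
    (h0 : a 0 ≤ x) (h1 : x < a (Fin.last n)) :
    ∃ i : Fin n, a i.castSucc ≤ x ∧ x < a i.succ := by
  classical
  have hne : (Finset.univ.filter (fun i : Fin (n + 1) => a i ≤ x)).Nonempty :=
    ⟨0, by simpa using h0⟩
  set M := (Finset.univ.filter (fun i : Fin (n + 1) => a i ≤ x)).max' hne with hM
  have hMle : a M ≤ x := by
    have := (Finset.univ.filter (fun i : Fin (n + 1) => a i ≤ x)).max'_mem hne
    simpa using this
  have hMne : M ≠ Fin.last n := by
    intro h
    rw [h] at hMle
    exact absurd h1 (not_lt.2 hMle)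
  have hMlt : (M : ℕ) < n := by
    have := Fin.lt_last_iff_ne_last.2 hMne
    simpa [Fin.lt_def] using this
  refine ⟨⟨M, hMlt⟩, ?_, ?_⟩
  · have : (⟨M, hMlt⟩ : Fin n).castSucc = M := by
      simp [Fin.castSucc, Fin.ext_iff]
    rw [this]; exact hMle
  · by_contra h
    push_neg at h
    have hmem : (⟨M, hMlt⟩ : Fin n).succ ∈
        Finset.univ.filter (fun i : Fin (n + 1) => a i ≤ x) := by
      simp only [Finset.mem_filter, Finset.mem_univ, true_and]
      exact h
    have hle := Finset.le_max' _ _ hmem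
    rw [← hM] at hle
    have : (M : ℕ) + 1 ≤ (M : ℕ) := by
      simpa [Fin.le_def] using hle
    omega

theorem isStep_combine {X : Type u} {Y : Type v} {k : ℕ} (f : Fin k → I01 → X)
    (hf : ∀ i, IsStep (f i)) (g : (Fin k → X) → Y) :
    IsStep (fun t => g (fun i => f i t)) := by
  classical
  choose n a h0 h1 hmono hconst using hf
  set D : Finset ℝ :=
    insert (0:ℝ) (insert 1 (Finset.univ.biUnion fun i : Fin k =>
      Finset.univ.image (a i))) with hD
  have h0D : (0:ℝ) ∈ D := by simp [hD]
  have h1D : (1:ℝ) ∈ D := by simp [hD]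
  have hDmem : ∀ x ∈ D, 0 ≤ x ∧ x ≤ 1 := by
    intro x hx
    simp only [hD, Finset.mem_insert, Finset.mem_biUnion, Finset.mem_image,
      Finset.mem_univ, true_and] at hx
    rcases hx with rfl | rfl | ⟨i, j, rfl⟩
    · norm_num
    · norm_num
    · constructor
      · have := (hmono i).monotone (Fin.zero_le j)
        rw [h0 i] at this; exact this
      · have := (hmono i).monotone (Fin.le_last j)
        rw [h1 i] at this; exact this
  obtain ⟨m, hm⟩ : ∃ m, D.card = m + 1 := by
    have : D.Nonempty := ⟨0, h0D⟩
    have := Finset.card_pos.2 this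
    exact ⟨D.card - 1, by omega⟩
  set b : Fin (m + 1) → ℝ := fun j => ((D.orderIsoOfFin hm j : ℝ)) with hb
  have hbmono : StrictMono b := fun i j hij => by
    exact_mod_cast (D.orderIsoOfFin hm).strictMono hij
  have hbD : ∀ j, b j ∈ D := fun j => (D.orderIsoOfFin hm j).2
  have hbsurj : ∀ x ∈ D, ∃ j, b j = x := by
    intro x hx
    obtain ⟨j, hj⟩ := (D.orderIsoOfFin hm).surjective ⟨x, hx⟩
    exact ⟨j, by rw [hb]; exact congrArg Subtype.val hj⟩
  have hb0 : b 0 = 0 := by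
    obtain ⟨j, hj⟩ := hbsurj 0 h0D
    have h1' : b 0 ≤ b j := hbmono.monotone (Fin.zero_le j)
    rw [hj] at h1'
    exact le_antisymm h1' (hDmem _ (hbD 0)).1
  have hb1 : b (Fin.last m) = 1 := by
    obtain ⟨j, hj⟩ := hbsurj 1 h1D
    have h1' : b j ≤ b (Fin.last m) := hbmono.monotone (Fin.le_last j)
    rw [hj] at h1'
    exact le_antisymm (hDmem _ (hbD _)).2 h1'
  have hcell : ∀ (j : Fin m) (x : ℝ), x ∈ D → b j.castSucc < x → x < b j.succ → False := by
    intro j x hx hlt hlt'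
    obtain ⟨l, rfl⟩ := hbsurj x hx
    have h1' : j.castSucc < l := hbmono.lt_iff_lt.1 hlt
    have h2' : l < j.succ := hbmono.lt_iff_lt.1 hlt'
    rw [Fin.lt_def] at h1' h2'
    simp only [Fin.coe_castSucc, Fin.val_succ] at h1' h2'
    omega
  refine ⟨m, b, hb0, hb1, hbmono, ?_⟩
  intro j s t hs ht
  refine congrArg g (funext fun i => ?_)
  have hs0 : a i 0 ≤ (s : ℝ) := by rw [h0 i]; exact s.2.1
  have hs1 : (s : ℝ) < a i (Fin.last (n i)) := by rw [h1 i]; exact s.2.2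
  obtain ⟨idx, hidx1, hidx2⟩ := exists_mem_cell (a i) s hs0 hs1
  have hlowD : a i idx.castSucc ∈ D := by
    simp only [hD, Finset.mem_insert, Finset.mem_biUnion, Finset.mem_image,
      Finset.mem_univ, true_and]
    exact Or.inr (Or.inr ⟨i, idx.castSucc, rfl⟩)
  have hupD : a i idx.succ ∈ D := by
    simp only [hD, Finset.mem_insert, Finset.mem_biUnion, Finset.mem_image,
      Finset.mem_univ, true_and]
    exact Or.inr (Or.inr ⟨i, idx.succ, rfl⟩)
  have hlow : a i idx.castSucc ≤ b j.castSucc := by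
    by_contra h
    push_neg at h
    exact hcell j _ hlowD h (lt_of_le_of_lt hidx1 hs.2)
  have hup : b j.succ ≤ a i idx.succ := by
    by_contra h
    push_neg at h
    exact hcell j _ hupD (lt_of_le_of_lt hs.1 hidx2) h
  exact hconst i idx s t ⟨hidx1, hidx2⟩
    ⟨le_trans hlow ht.1, lt_of_lt_of_le ht.2 hup⟩

/-! ### Universal topological algebras of continuous signature -/

/-- A topological `ℰ`-algebra (the algebraic data): a topological space together with
operations `eₙ : Eₙ × Xⁿ → X`.  Continuity of the operations is expressed by
`ContinuousOps`. -/
structure EAlg (E : ℕ → Type u) [∀ n, TopologicalSpace (E n)] : Type (u + 1) where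
  carrier : Type u
  top : TopologicalSpace carrier
  ops : ∀ n : ℕ, E n × (Fin n → carrier) → carrier

attribute [instance] EAlg.top

variable {E : ℕ → Type u} [∀ n, TopologicalSpace (E n)]

/-- The algebraic operations of `A` are all continuous, i.e. `A` is a topological
`ℰ`-algebra in the sense of Choban. -/
def ContinuousOps (A : EAlg E) : Prop := ∀ n : ℕ, Continuous (A.ops n)

/-- A homomorphism of `ℰ`-algebras. -/
def IsHom (A B : EAlg E) (h : A.carrier → B.carrier) : Prop :=
  ∀ (n : ℕ) (c : E n) (x : Fin n → A.carrier),
    h (A.ops n (c, x)) = B.ops n (c, fun i => h (x i))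

/-- `(F, i)` is a free universal `ℰ`-algebra of the space `X` in the class `K`. -/
def IsFreeAlg (K : EAlg E → Prop) (X : Type u) [TopologicalSpace X]
    (F : EAlg E) (i : X → F.carrier) : Prop :=
  K F ∧ Continuous i ∧
    ∀ B : EAlg E, K B → ∀ f : X → B.carrier, Continuous f →
      ∃! h : F.carrier → B.carrier,
        Continuous h ∧ IsHom F B h ∧ ∀ x, h (i x) = f x

/-- `S` is (the underlying set of) a subalgebra of `A`. -/
def IsSubalgebra (A : EAlg E) (S : Set A.carrier) : Prop :=
  ∀ (n : ℕ) (c : E n) (x : Fin n → A.carrier), (∀ i, x i ∈ S) → A.ops n (c, x) ∈ S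

/-- The subalgebra of `A` on a closed-under-operations subset `S`, with the subspace
topology. -/
def Subalg (A : EAlg E) (S : Set A.carrier) (hS : IsSubalgebra A S) : EAlg E where
  carrier := S
  top := inferInstance
  ops := fun n p => ⟨A.ops n (p.1, fun i => (p.2 i : A.carrier)),
    hS n p.1 _ fun i => (p.2 i).2⟩

/-- The Cartesian product of a family of `ℰ`-algebras, with the product topology and
pointwise operations. -/
def ProdAlg {ι : Type u} (A : ι → EAlg E) : EAlg E where
  carrier := ∀ i, (A i).carrier
  top := inferInstance
  ops := fun n p i => (A i).ops n (p.1, fun j => p.2 j i)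

/-- A quasivariety: a class of `ℰ`-algebras closed under subalgebras and arbitrary
Cartesian products. -/
def IsQuasivariety (K : EAlg E → Prop) : Prop :=
  (∀ (A : EAlg E) (S : Set A.carrier) (hS : IsSubalgebra A S), K A → K (Subalg A S hS)) ∧
  (∀ (ι : Type u) (A : ι → EAlg E), (∀ i, K (A i)) → K (ProdAlg A))

/-- A complete quasivariety: a quasivariety containing every completely regular
`ℰ`-algebra algebraically isomorphic to one of its members. -/
def IsCompleteQuasivariety (K : EAlg E → Prop) : Prop :=
  IsQuasivariety K ∧
  ∀ A B : EAlg E, K B → CompletelyRegularSpace A.carrier →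
    (∃ h : A.carrier → B.carrier, Function.Bijective h ∧ IsHom A B h) → K A

/-- The pointwise operations on `HM X` induced from operations on `X`. -/
def hmOps {X : Type u} (e : ∀ n : ℕ, E n × (Fin n → X) → X) (n : ℕ)
    (p : E n × (Fin n → HM X)) : HM X :=
  ⟨fun t => e n (p.1, fun i => (p.2 i).1 t),
    isStep_combine (fun i => (p.2 i).1) (fun i => (p.2 i).2) (fun v => e n (p.1, v))⟩

/-- The Hartman–Mycielski algebra `HM(A)` of an `ℰ`-algebra `A`: step functions with
the Hartman–Mycielski topology and pointwise operations. -/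
def HMAlg (A : EAlg E) : EAlg E where
  carrier := HM A.carrier
  top := hmTopologicalSpace A.carrier
  ops := hmOps A.ops

/-- A stratifiable space: a regular space with a monotone stratification `G`. -/
def Stratifiable (X : Type u) [TopologicalSpace X] : Prop :=
  RegularSpace X ∧
  ∃ G : ℕ → Set X → Set X,
    (∀ (n : ℕ) (H : Set X), IsClosed H → IsOpen (G n H) ∧ H ⊆ G n H) ∧
    (∀ H : Set X, IsClosed H → H = ⋂ n : ℕ, closure (G n H)) ∧
    (∀ (n : ℕ) (H K : Set X), IsClosed H → IsClosed K → H ⊆ K → G n H ⊆ G n K)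


/-- A step function is constant on a right neighborhood of every point. -/
theorem IsStep.exists_const_right {X : Type u} {f : I01 → X} (hf : IsStep f) (t : I01) :
    ∃ b : ℝ, (t : ℝ) < b ∧ b ≤ 1 ∧ ∀ s : I01, (s : ℝ) ∈ Set.Ico (t : ℝ) b → f s = f t := by
  obtain ⟨n, p, h0, h1, hmono, hconst⟩ := hf
  obtain ⟨i, hi, hi'⟩ := exists_mem_cell p t (h0.trans_le t.2.1) (t.2.2.trans_eq h1.symm)
  refine ⟨p i.succ, hi', h1 ▸ hmono.monotone (Fin.le_last _), fun s hs => ?_⟩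
  exact hconst i s t ⟨hi.trans hs.1, hs.2⟩ ⟨hi, hi'⟩

/-- The set of `t ∈ [a,b)` at which `g` takes a value outside `V`. -/
def badSet {X : Type u} (g : HM X) (a b : ℝ) (V : Set X) : Set ℝ :=
  {t : ℝ | ∃ ht : t ∈ I01, t ∈ Set.Ico a b ∧ g.1 ⟨t, ht⟩ ∉ V}

theorem mem_hmBasicSet {X : Type u} {a b ε : ℝ} {V : Set X} {g : HM X} :
    g ∈ hmBasicSet a b V ε ↔ volume (badSet g a b V) < ENNReal.ofReal ε :=
  Iff.rfl

theorem mem_hmBasicSet_of_forall {X : Type u} {a b ε : ℝ} {V : Set X} {g : HM X} (hε : 0 < ε)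
    (h : ∀ t : I01, (t : ℝ) ∈ Set.Ico a b → g.1 t ∈ V) : g ∈ hmBasicSet a b V ε := by
  have hempty : badSet g a b V = ∅ :=
    Set.eq_empty_of_forall_notMem fun t ⟨ht, htab, htV⟩ => htV (h ⟨t, ht⟩ htab)
  simpa [mem_hmBasicSet, hempty] using hε

theorem isOpen_hmBasicSet {X : Type u} [TopologicalSpace X] {a b : ℝ} (ha : 0 ≤ a) (hb : b ≤ 1)
    {V : Set X} (hV : IsOpen V) (ε : ℝ) : IsOpen (hmBasicSet a b V ε) := by
  classical
  intro g hg
  change hmBasicSet a b V ε ∈ Filter.generate (hmSubbasis g)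
  rw [mem_hmBasicSet] at hg
  obtain ⟨n, p, h0, h1, hmono, hconst⟩ := g.2
  obtain ⟨r, hr0, hr⟩ : ∃ r : ℝ, 0 < r ∧
      volume (badSet g a b V) + n * ENNReal.ofReal r < ENNReal.ofReal ε := by
    have hfin : volume (badSet g a b V) ≠ ⊤ := hg.ne_top
    set m := (volume (badSet g a b V)).toReal with hm
    have hm0 : 0 ≤ m := ENNReal.toReal_nonneg
    rw [← ENNReal.ofReal_toReal hfin, ← hm] at hg ⊢
    have hlt : m < ε := (ENNReal.ofReal_lt_ofReal_iff_of_nonneg hm0).1 hg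
    have hn : (0 : ℝ) < n + 1 := by positivity
    have hr : 0 < (ε - m) / (n + 1) := div_pos (sub_pos.2 hlt) hn
    refine ⟨_, hr, ?_⟩
    rw [← ENNReal.ofReal_natCast, ← ENNReal.ofReal_mul n.cast_nonneg,
      ← ENNReal.ofReal_add hm0 (by positivity), ENNReal.ofReal_lt_ofReal_iff (hm0.trans_lt hlt)]
    have := div_mul_cancel₀ (ε - m) hn.ne'
    linarith
  let c : Fin n → ℝ := fun i => max a (p i.castSucc)
  let d : Fin n → ℝ := fun i => min b (p i.succ)
  let good : Fin n → Prop := fun i => ∃ s : I01, (s : ℝ) ∈ Set.Ico (c i) (d i) ∧ g.1 s ∈ V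
  have hcell : ∀ i, ∀ s : I01, (s : ℝ) ∈ Set.Ico (c i) (d i) →
      (s : ℝ) ∈ Set.Ico (p i.castSucc) (p i.succ) := fun i s hs =>
    ⟨(le_max_right _ _).trans hs.1, hs.2.trans_le (min_le_right _ _)⟩
  have hmem : (⋂ i, {h : HM X | good i → h ∈ hmBasicSet (c i) (d i) V r}) ∈
      Filter.generate (hmSubbasis g) := by
    refine Filter.iInter_mem.2 fun i => ?_
    by_cases hi : good i
    · refine Filter.mem_of_superset (Filter.mem_generate_of_mem
        (U := hmBasicSet (c i) (d i) V r) ?_) fun h hh _ => hh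
      obtain ⟨s, hs, hsV⟩ := hi
      have hcd := hs.1.trans_lt hs.2
      have hc0 : 0 ≤ c i := ha.trans (le_max_left _ _)
      have hd1 : d i ≤ 1 := (min_le_left _ _).trans hb
      refine ⟨c i, d i, hc0, hcd, hd1, V, r, hr0,
        fun s t hs ht => hconst i s t (hcell i s hs) (hcell i t ht), hV.mem_nhds ?_, rfl⟩
      rwa [hconst i _ s (hcell i ⟨c i, hc0, hcd.trans_le hd1⟩ ⟨le_rfl, hcd⟩) (hcell i s hs)]
    · exact Filter.mem_of_superset Filter.univ_mem fun h _ hi' => absurd hi' hi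
  refine Filter.mem_of_superset hmem fun h hh => ?_
  rw [Set.mem_iInter] at hh
  rw [mem_hmBasicSet]
  let B : Fin n → Set ℝ := fun i => if good i then badSet h (c i) (d i) V else ∅
  have hB : ∀ i, volume (B i) ≤ ENNReal.ofReal r := by
    intro i
    by_cases hi : good i
    · simpa only [B, if_pos hi] using (mem_hmBasicSet.1 (hh i hi)).le
    · simp [B, if_neg hi]
  have hsub : badSet h a b V ⊆ badSet g a b V ∪ ⋃ i, B i := by
    rintro t ⟨ht, htab, htV⟩
    by_cases hgt : g.1 ⟨t, ht⟩ ∈ V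
    · obtain ⟨i, hi, hi'⟩ := exists_mem_cell p t (h0.trans_le ht.1) (ht.2.trans_eq h1.symm)
      have htcd : t ∈ Set.Ico (c i) (d i) := ⟨max_le htab.1 hi, lt_min htab.2 hi'⟩
      have hgood : good i := ⟨⟨t, ht⟩, htcd, hgt⟩
      refine Or.inr (Set.mem_iUnion.2 ⟨i, ?_⟩)
      simp only [B, if_pos hgood]
      exact ⟨ht, htcd, htV⟩
    · exact Or.inl ⟨ht, htab, hgt⟩
  calc volume (badSet h a b V)
      ≤ volume (badSet g a b V) + volume (⋃ i, B i) :=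
        (measure_mono hsub).trans (measure_union_le _ _)
    _ ≤ volume (badSet g a b V) + ∑ i, volume (B i) := by
        gcongr
        exact measure_iUnion_fintype_le _ _
    _ ≤ volume (badSet g a b V) + n * ENNReal.ofReal r := by
        gcongr
        simpa using Finset.sum_le_card_nsmul Finset.univ _ _ fun i _ => hB i
    _ < ENNReal.ofReal ε := hr

theorem disjoint_hmBasicSet {X : Type u} {a b : ℝ} (ha : 0 ≤ a) (hab : a < b) (hb : b ≤ 1)
    {V W : Set X} (hVW : Disjoint V W) :
    Disjoint (hmBasicSet a b V ((b - a) / 2)) (hmBasicSet a b W ((b - a) / 2)) := by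
  refine Set.disjoint_left.2 fun h hhV hhW => ?_
  rw [mem_hmBasicSet] at hhV hhW
  have hsub : Set.Ico a b ⊆ badSet h a b V ∪ badSet h a b W := by
    intro t ht
    have htI : t ∈ I01 := ⟨ha.trans ht.1, ht.2.trans_le hb⟩
    by_cases htV : h.1 ⟨t, htI⟩ ∈ V
    · exact Or.inr ⟨htI, ht, Set.disjoint_left.1 hVW htV⟩
    · exact Or.inl ⟨htI, ht, htV⟩
  have hle := (measure_mono (μ := volume) hsub).trans (measure_union_le _ _)
  have hlt := hle.trans_lt (ENNReal.add_lt_add hhV hhW)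
  have hpos : 0 ≤ (b - a) / 2 := by linarith
  rw [Real.volume_Ico, ← ENNReal.ofReal_add hpos hpos, add_halves] at hlt
  exact lt_irrefl _ hlt

/-- If `X` is Hausdorff then so is `HM(X)` with the Hartman–Mycielski topology. -/
theorem t2Space_hm (X : Type u) [TopologicalSpace X] [T2Space X] : T2Space (HM X) := by
  refine ⟨fun f g hfg => ?_⟩
  obtain ⟨t, ht⟩ : ∃ t, f.1 t ≠ g.1 t := by
    by_contra! h
    exact hfg (Subtype.ext (funext h))
  obtain ⟨b₁, htb₁, hb₁, hf⟩ := f.2.exists_const_right t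
  obtain ⟨b₂, htb₂, -, hg⟩ := g.2.exists_const_right t
  obtain ⟨V, W, hV, hW, hfV, hgW, hVW⟩ := t2_separation ht
  have htb : (t : ℝ) < min b₁ b₂ := lt_min htb₁ htb₂
  have hb : min b₁ b₂ ≤ 1 := (min_le_left _ _).trans hb₁
  have hε : 0 < (min b₁ b₂ - t) / 2 := half_pos (sub_pos.2 htb)
  refine ⟨_, _, isOpen_hmBasicSet t.2.1 hb hV _, isOpen_hmBasicSet t.2.1 hb hW _,
    mem_hmBasicSet_of_forall hε fun s hs => ?_, mem_hmBasicSet_of_forall hε fun s hs => ?_,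
    disjoint_hmBasicSet t.2.1 htb hb hVW⟩
  · rwa [hf s ⟨hs.1, hs.2.trans_le (min_le_left _ _)⟩]
  · rwa [hg s ⟨hs.1, hs.2.trans_le (min_le_right _ _)⟩]

end HMPaper
end

section
/- If X is a Tychonoff (completely regular Hausdorff) topological space, then HM(X) with the Hartman–Mycielski topology is a Tychonoff topological space. -/
open Set MeasureTheory Topology

universe u v

namespace HMPaper

variable {E : ℕ → Type u} [∀ n, TopologicalSpace (E n)]

section Tychonoff

variable {X : Type u}

theorem measurableSet_preimage_step (g : HM X) (S : Set X) :
    MeasurableSet {t : ℝ | ∃ ht : t ∈ I01, g.1 ⟨t, ht⟩ ∈ S} := by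
  obtain ⟨g, n, a, h0, h1, hm, hc⟩ := g
  have hI : ∀ i, 0 ≤ a i ∧ a i ≤ 1 := fun i =>
    ⟨h0 ▸ hm.monotone (Fin.zero_le i), h1 ▸ hm.monotone (Fin.le_last i)⟩
  have heq : {t : ℝ | ∃ ht : t ∈ I01, g ⟨t, ht⟩ ∈ S} =
      ⋃ i : Fin n, ⋃ (_ : ∃ s : I01, (s : ℝ) ∈ Ico (a i.castSucc) (a i.succ) ∧ g s ∈ S),
        Ico (a i.castSucc) (a i.succ) := by
    ext t
    simp only [mem_ofPred_eq, mem_iUnion, exists_prop]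
    constructor
    · rintro ⟨ht, hS⟩
      obtain ⟨i, hi⟩ := exists_mem_cell a t (h0 ▸ ht.1) (h1 ▸ ht.2)
      exact ⟨i, ⟨⟨t, ht⟩, hi, hS⟩, hi⟩
    · rintro ⟨i, ⟨s, hs, hS⟩, ht⟩
      have htI : t ∈ I01 := ⟨(hI _).1.trans ht.1, ht.2.trans_le (hI _).2⟩
      exact ⟨htI, hc i s ⟨t, htI⟩ hs ht ▸ hS⟩
  change MeasurableSet {t : ℝ | ∃ ht : t ∈ I01, g ⟨t, ht⟩ ∈ S}
  rw [heq]
  exact .iUnion fun i => .iUnion fun _ => measurableSet_Ico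

open Classical in
/-- The composition of a step function with a real function, extended by zero to `ℝ`. -/
noncomputable def stepExtend (p : X → unitInterval) (g : HM X) (t : ℝ) : ℝ :=
  if ht : t ∈ I01 then p (g.1 ⟨t, ht⟩) else 0

theorem stepExtend_of_mem (p : X → unitInterval) (g : HM X) {t : ℝ} (ht : t ∈ I01) :
    stepExtend p g t = p (g.1 ⟨t, ht⟩) := dif_pos ht

theorem stepExtend_of_notMem (p : X → unitInterval) (g : HM X) {t : ℝ} (ht : t ∉ I01) :
    stepExtend p g t = 0 := dif_neg ht

theorem stepExtend_nonneg (p : X → unitInterval) (g : HM X) (t : ℝ) :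
    0 ≤ stepExtend p g t := by
  by_cases ht : t ∈ I01
  · rw [stepExtend_of_mem p g ht]; exact (p _).2.1
  · rw [stepExtend_of_notMem p g ht]

theorem stepExtend_le_one (p : X → unitInterval) (g : HM X) (t : ℝ) :
    stepExtend p g t ≤ 1 := by
  by_cases ht : t ∈ I01
  · rw [stepExtend_of_mem p g ht]; exact (p _).2.2
  · rw [stepExtend_of_notMem p g ht]; exact zero_le_one

theorem measurable_stepExtend (p : X → unitInterval) (g : HM X) :
    Measurable (stepExtend p g) := by
  intro s _
  have heq : stepExtend p g ⁻¹' s =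
      {t : ℝ | ∃ ht : t ∈ I01, g.1 ⟨t, ht⟩ ∈ {x | (p x : ℝ) ∈ s}} ∪
        (I01ᶜ ∩ {_t : ℝ | (0 : ℝ) ∈ s}) := by
    ext t
    by_cases ht : t ∈ I01
    · simp only [mem_preimage, stepExtend_of_mem p g ht, mem_union, mem_inter_iff,
        mem_compl_iff, ht, not_true, false_and, or_false, mem_ofPred_eq, exists_true_left]
    · simp only [mem_preimage, stepExtend_of_notMem p g ht, mem_union, mem_inter_iff,
        mem_compl_iff, ht, not_false_eq_true, true_and, mem_ofPred_eq, IsEmpty.exists_iff,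
        false_or]
  rw [heq]
  exact (measurableSet_preimage_step g _).union (measurableSet_Ico.compl.inter (.const _))

theorem integrable_stepExtend (p : X → unitInterval) (g : HM X) :
    Integrable (stepExtend p g) := by
  have hI : Integrable (I01.indicator fun _ : ℝ => (1 : ℝ)) :=
    (integrable_indicator_iff measurableSet_Ico).2 (integrableOn_const (by simp))
  refine hI.mono' (measurable_stepExtend p g).aestronglyMeasurable (.of_forall fun t => ?_)
  rw [Real.norm_of_nonneg (stepExtend_nonneg p g t)]
  by_cases ht : t ∈ I01
  · simpa [indicator_of_mem ht] using stepExtend_le_one p g t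
  · simp [stepExtend_of_notMem p g ht, indicator_of_notMem ht]

/-- The integral functional `g ↦ ∫ₐᵇ p (g t) dt` on step functions. -/
noncomputable def stepIntegral (p : X → unitInterval) (a b : ℝ) (g : HM X) : ℝ :=
  ∫ t in Ico a b, stepExtend p g t

theorem abs_stepIntegral_sub_le (p : X → unitInterval) (a b : ℝ) (f g : HM X) {δ : ℝ}
    (hδ : 0 < δ)
    (h : volume {t | δ ≤ |stepExtend p g t - stepExtend p f t|} ≤ ENNReal.ofReal δ) :
    |stepIntegral p a b g - stepIntegral p a b f| ≤ 2 * δ := by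
  set B := {t | δ ≤ |stepExtend p g t - stepExtend p f t|}
  have hB : MeasurableSet B :=
    measurableSet_le measurable_const
      ((measurable_stepExtend p g).sub (measurable_stepExtend p f)).abs
  have hBfin : volume B ≠ ⊤ := ne_top_of_le_ne_top ENNReal.ofReal_ne_top h
  have hd := (integrable_stepExtend p g).sub (integrable_stepExtend p f)
  have hI : Integrable (I01.indicator fun _ : ℝ => δ) :=
    (integrable_indicator_iff measurableSet_Ico).2 (integrableOn_const (by simp))
  have hJ : Integrable (B.indicator fun _ : ℝ => (1 : ℝ)) :=
    (integrable_indicator_iff hB).2 (integrableOn_const hBfin)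
  have hle : ∀ t, |stepExtend p g t - stepExtend p f t| ≤
      I01.indicator (fun _ : ℝ => δ) t + B.indicator (fun _ : ℝ => (1 : ℝ)) t := by
    intro t
    by_cases htB : t ∈ B
    · rw [indicator_of_mem htB]
      have : 0 ≤ I01.indicator (fun _ : ℝ => δ) t := indicator_nonneg (fun _ _ => hδ.le) t
      have : |stepExtend p g t - stepExtend p f t| ≤ 1 := abs_sub_le_iff.2
        ⟨by linarith [stepExtend_nonneg p f t, stepExtend_le_one p g t],
          by linarith [stepExtend_nonneg p g t, stepExtend_le_one p f t]⟩
      linarith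
    · rw [indicator_of_notMem htB, add_zero]
      by_cases ht : t ∈ I01
      · rw [indicator_of_mem ht]
        exact (not_le.1 htB).le
      · simp [stepExtend_of_notMem _ _ ht, indicator_of_notMem ht]
  calc |stepIntegral p a b g - stepIntegral p a b f|
      = |∫ t in Ico a b, (stepExtend p g t - stepExtend p f t)| := by
        rw [stepIntegral, stepIntegral, integral_sub (integrable_stepExtend p g).integrableOn
          (integrable_stepExtend p f).integrableOn]
    _ ≤ ∫ t in Ico a b, |stepExtend p g t - stepExtend p f t| := abs_integral_le_integral_abs
    _ ≤ ∫ t, |stepExtend p g t - stepExtend p f t| :=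
        setIntegral_le_integral hd.abs (.of_forall fun _ => abs_nonneg _)
    _ ≤ ∫ t, (I01.indicator (fun _ : ℝ => δ) t + B.indicator (fun _ : ℝ => (1 : ℝ)) t) :=
        integral_mono hd.abs (hI.add hJ) hle
    _ = δ + volume.real B := by
        rw [integral_add hI hJ, integral_indicator measurableSet_Ico, integral_indicator hB]
        simp
    _ ≤ 2 * δ := by
        have : volume.real B ≤ δ := ENNReal.toReal_le_of_le_ofReal hδ.le h
        linarith

theorem stepIntegral_of_const (p : X → unitInterval) {a b : ℝ} (ha : 0 ≤ a) (hab : a < b)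
    (hb : b ≤ 1) (f : HM X)
    (hf : ∀ s t : I01, (s : ℝ) ∈ Ico a b → (t : ℝ) ∈ Ico a b → f.1 s = f.1 t) :
    stepIntegral p a b f = (b - a) * p (f.1 ⟨a, ha, hab.trans_le hb⟩) := by
  have : ∀ t ∈ Ico a b, stepExtend p f t = p (f.1 ⟨a, ha, hab.trans_le hb⟩) := fun t ht => by
    rw [stepExtend_of_mem p f ⟨ha.trans ht.1, ht.2.trans_le hb⟩,
      hf _ ⟨a, ha, hab.trans_le hb⟩ ht ⟨le_rfl, hab⟩]
  rw [stepIntegral, setIntegral_congr_fun measurableSet_Ico this]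
  simp [hab.le]

theorem mem_hmBasicSet_of_stepIntegral_lt {p : X → unitInterval} {V : Set X}
    (hp : EqOn p 1 Vᶜ) {a b ε : ℝ} (g : HM X) (hg : stepIntegral p a b g < ε) :
    g ∈ hmBasicSet a b V ε := by
  set B := {t : ℝ | ∃ ht : t ∈ I01, t ∈ Ico a b ∧ g.1 ⟨t, ht⟩ ∉ V} with hBdef
  have hBeq : B = {t : ℝ | ∃ ht : t ∈ I01, g.1 ⟨t, ht⟩ ∈ Vᶜ} ∩ Ico a b := by
    ext t
    simp only [hBdef, mem_ofPred_eq, mem_inter_iff, mem_compl_iff]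
    exact ⟨fun ⟨h, h1, h2⟩ => ⟨⟨h, h2⟩, h1⟩, fun ⟨⟨h, h2⟩, h1⟩ => ⟨h, h1, h2⟩⟩
  have hB : MeasurableSet B := hBeq ▸ (measurableSet_preimage_step g _).inter measurableSet_Ico
  have hBsub : B ⊆ Ico a b := fun t ⟨_, h, _⟩ => h
  have hBfin : volume B ≠ ⊤ := ne_top_of_le_ne_top (by simp) (measure_mono hBsub)
  have hle : volume.real B ≤ stepIntegral p a b g := by
    calc volume.real B = ∫ t in B, stepExtend p g t := by
          rw [setIntegral_congr_fun (g := fun _ => (1 : ℝ)) hB]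
          · simp
          · rintro t ⟨ht, _, hV⟩
            simp [stepExtend_of_mem p g ht, hp hV]
      _ ≤ stepIntegral p a b g :=
          setIntegral_mono_set (integrable_stepExtend p g).integrableOn
            (.of_forall fun t => stepExtend_nonneg p g t) hBsub.eventuallyLE
  change volume B < ENNReal.ofReal ε
  rw [← ENNReal.ofReal_toReal hBfin]
  exact (ENNReal.ofReal_lt_ofReal_iff_of_nonneg ENNReal.toReal_nonneg).2 (hle.trans_lt hg)

variable [TopologicalSpace X]

theorem eventually_volume_stepExtend_sub_le {p : X → unitInterval} (hp : Continuous p)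
    (f : HM X) {δ : ℝ} (hδ : 0 < δ) :
    ∀ᶠ g in Filter.generate (hmSubbasis f),
      volume {t | δ ≤ |stepExtend p g t - stepExtend p f t|} ≤ ENNReal.ofReal δ := by
  obtain ⟨n, a, h0, h1, hm, hc⟩ := f.2
  have hI : ∀ i, 0 ≤ a i ∧ a i ≤ 1 := fun i =>
    ⟨h0 ▸ hm.monotone (Fin.zero_le i), h1 ▸ hm.monotone (Fin.le_last i)⟩
  have hlt : ∀ i : Fin n, a i.castSucc < a i.succ := fun i => hm i.castSucc_lt_succ
  let x : Fin n → X := fun i => f.1 ⟨a i.castSucc, (hI _).1, (hlt i).trans_le (hI _).2⟩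
  let V : Fin n → Set X := fun i => {y | |(p y : ℝ) - p (x i)| < δ}
  have hN : ∀ᶠ g in Filter.generate (hmSubbasis f), ∀ i : Fin n,
      g ∈ hmBasicSet (a i.castSucc) (a i.succ) (V i) (δ / (n + 1)) := by
    refine Filter.eventually_all.2 fun i => Filter.mem_generate_of_mem ?_
    refine ⟨_, _, (hI _).1, hlt i, (hI _).2, V i, _, by positivity, hc i, ?_, rfl⟩
    have hcont : Continuous fun y => |(p y : ℝ) - p (x i)| := by fun_prop
    exact (isOpen_lt hcont continuous_const).mem_nhds (by simpa [x] using hδ)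
  filter_upwards [hN] with g hg
  have hsub : {t | δ ≤ |stepExtend p g t - stepExtend p f t|} ⊆
      ⋃ i : Fin n, {t : ℝ | ∃ ht : t ∈ I01,
        t ∈ Ico (a i.castSucc) (a i.succ) ∧ g.1 ⟨t, ht⟩ ∉ V i} := by
    intro t hδt
    rw [mem_ofPred_eq] at hδt
    by_cases ht : t ∈ I01
    · obtain ⟨i, hi⟩ := exists_mem_cell a t (h0 ▸ ht.1) (h1 ▸ ht.2)
      refine mem_iUnion.2 ⟨i, ht, hi, fun hV => hδt.not_gt ?_⟩
      have hx : f.1 ⟨t, ht⟩ = x i := hc i _ _ hi ⟨le_rfl, hlt i⟩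
      rw [stepExtend_of_mem p g ht, stepExtend_of_mem p f ht, hx]
      exact hV
    · simp only [stepExtend_of_notMem _ _ ht, sub_self, abs_zero] at hδt
      exact absurd hδ (not_lt.2 hδt)
  calc volume {t | δ ≤ |stepExtend p g t - stepExtend p f t|}
      ≤ ∑ i : Fin n, volume {t : ℝ | ∃ ht : t ∈ I01,
          t ∈ Ico (a i.castSucc) (a i.succ) ∧ g.1 ⟨t, ht⟩ ∉ V i} :=
        (measure_mono hsub).trans (measure_iUnion_fintype_le _ _)
    _ ≤ ∑ _i : Fin n, ENNReal.ofReal (δ / (n + 1)) := Finset.sum_le_sum fun i _ => (hg i).le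
    _ = ENNReal.ofReal (∑ _i : Fin n, δ / (n + 1)) :=
        (ENNReal.ofReal_sum_of_nonneg fun _ _ => by positivity).symm
    _ ≤ ENNReal.ofReal δ := by
        refine ENNReal.ofReal_le_ofReal ?_
        rw [Finset.sum_const, Finset.card_univ, Fintype.card_fin, nsmul_eq_mul, mul_div_assoc',
          div_le_iff₀ (by positivity)]
        nlinarith

theorem tendsto_stepIntegral {p : X → unitInterval} (hp : Continuous p) (a b : ℝ) (f : HM X) :
    Filter.Tendsto (stepIntegral p a b) (Filter.generate (hmSubbasis f))
      (𝓝 (stepIntegral p a b f)) := by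
  refine Metric.tendsto_nhds.2 fun ε hε => ?_
  have hδ : 0 < ε / 3 := by positivity
  filter_upwards [eventually_volume_stepExtend_sub_le hp f hδ] with g hg
  have := abs_stepIntegral_sub_le p a b f g hδ hg
  rw [Real.dist_eq]
  linarith

theorem continuous_stepIntegral {p : X → unitInterval} (hp : Continuous p) (a b : ℝ) :
    Continuous (stepIntegral (X := X) p a b) :=
  ⟨fun _ hU f hf => tendsto_stepIntegral hp a b f (hU.mem_nhds hf)⟩

/-- On a completely regular space the Hartman–Mycielski topology is the initial topology for the
functionals `g ↦ ∫ₐᵇ p (g t) dt`. -/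
theorem hmTopologicalSpace_eq_iInf_induced [CompletelyRegularSpace X] :
    hmTopologicalSpace X = ⨅ q : C(X, unitInterval) × ℝ × ℝ,
      TopologicalSpace.induced (stepIntegral q.1 q.2.1 q.2.2) inferInstance := by
  refine le_antisymm
    (le_iInf fun q => (continuous_stepIntegral q.1.continuous _ _).le_induced) ?_
  suffices h : ∀ f : HM X, @nhds _ (⨅ q : C(X, unitInterval) × ℝ × ℝ,
      TopologicalSpace.induced (stepIntegral q.1 q.2.1 q.2.2) inferInstance) f ≤
        Filter.generate (hmSubbasis f) from
    fun U hU => (@isOpen_iff_mem_nhds _ (_) _).2 fun f hf => h f (hU f hf)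
  refine fun f => Filter.le_generate_iff.2 ?_
  rintro _ ⟨a, b, ha, hab, hb, V, ε, hε, hconst, hV, rfl⟩
  obtain ⟨W, hWV, hW, hfW⟩ := mem_nhds_iff.1 hV
  obtain ⟨p, hp, hp0, hp1⟩ := CompletelyRegularSpace.completely_regular_isOpen _ W hW hfW
  have hf0 : stepIntegral p a b f = 0 := by
    rw [stepIntegral_of_const p ha hab hb f hconst, hp0]
    simp
  rw [nhds_iInf]
  refine Filter.mem_iInf_of_mem (⟨⟨p, hp⟩, a, b⟩ : C(X, unitInterval) × ℝ × ℝ) ?_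
  rw [nhds_induced]
  refine ⟨Iio ε, Iio_mem_nhds (hf0.trans_lt hε), fun g hg => ?_⟩
  exact mem_hmBasicSet_of_stepIntegral_lt (hp1.mono (compl_subset_compl.2 hWV)) g hg

end Tychonoff

theorem exists_Ico_const {X : Type u} (f : HM X) {t : ℝ} (ht : t ∈ I01) :
    ∃ b, t < b ∧ b ≤ 1 ∧
      ∀ r s : I01, (r : ℝ) ∈ Ico t b → (s : ℝ) ∈ Ico t b → f.1 r = f.1 s := by
  obtain ⟨n, a, h0, h1, hm, hc⟩ := f.2
  obtain ⟨i, hi1, hi2⟩ := exists_mem_cell a t (h0 ▸ ht.1) (h1 ▸ ht.2)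
  exact ⟨a i.succ, hi2, h1 ▸ hm.monotone (Fin.le_last _), fun r s hr hs =>
    hc i r s ⟨hi1.trans hr.1, hr.2⟩ ⟨hi1.trans hs.1, hs.2⟩⟩

theorem exists_stepIntegral_ne {X : Type u} [TopologicalSpace X] [CompletelyRegularSpace X]
    [T1Space X] {f g : HM X} (hfg : f ≠ g) :
    ∃ (p : X → unitInterval) (a b : ℝ), Continuous p ∧
      stepIntegral p a b f ≠ stepIntegral p a b g := by
  obtain ⟨⟨t, ht⟩, hne⟩ := Function.ne_iff.1 fun h => hfg (Subtype.ext h)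
  obtain ⟨b, htb, hb, hbc⟩ := exists_Ico_const f ht
  obtain ⟨c, htc, hc, hcc⟩ := exists_Ico_const g ht
  obtain ⟨p, hp, hp0, hp1⟩ := CompletelyRegularSpace.completely_regular (f.1 ⟨t, ht⟩)
    {g.1 ⟨t, ht⟩} isClosed_singleton hne
  have htd : t < min b c := lt_min htb htc
  refine ⟨p, t, min b c, hp, ?_⟩
  rw [stepIntegral_of_const p ht.1 htd (min_le_of_left_le hb) f fun r s hr hs =>
      hbc r s ⟨hr.1, hr.2.trans_le (min_le_left _ _)⟩ ⟨hs.1, hs.2.trans_le (min_le_left _ _)⟩,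
    stepIntegral_of_const p ht.1 htd (min_le_of_left_le hb) g fun r s hr hs =>
      hcc r s ⟨hr.1, hr.2.trans_le (min_le_right _ _)⟩ ⟨hs.1, hs.2.trans_le (min_le_right _ _)⟩,
    hp0, hp1 rfl]
  simpa using (sub_pos.2 htd).ne

/-- If `X` is Tychonoff (completely regular Hausdorff) then so is `HM(X)` with the
Hartman–Mycielski topology. -/
theorem tychonoff_hm (X : Type u) [TopologicalSpace X] [CompletelyRegularSpace X]
    [T2Space X] : CompletelyRegularSpace (HM X) ∧ T2Space (HM X) := by
  constructor
  · rw [hmTopologicalSpace_eq_iInf_induced]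
    exact completelyRegularSpace_iInf fun q =>
      completelyRegularSpace_induced inferInstance _
  · refine ⟨fun f g hfg => ?_⟩
    obtain ⟨p, a, b, hp, hne⟩ := exists_stepIntegral_ne hfg
    exact separated_by_continuous (continuous_stepIntegral hp a b) hne

end HMPaper
end

section
/- For any Hausdorff topological space X, the canonical map hm_X : X → HM(X) is a closed topological embedding. -/
open Set MeasureTheory Topology

universe u v

namespace HMPaper

variable {E : ℕ → Type u} [∀ n, TopologicalSpace (E n)]

theorem hmBasicSet_mem_generate {X : Type u} [TopologicalSpace X] (f : HM X) {a b : ℝ}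
    (ha : 0 ≤ a) (hab : a < b) (hb : b ≤ 1)
    (hf : ∀ s t : I01, (s : ℝ) ∈ Set.Ico a b → (t : ℝ) ∈ Set.Ico a b → f.1 s = f.1 t)
    {V : Set X} (hV : V ∈ nhds (f.1 ⟨a, ha, hab.trans_le hb⟩)) {ε : ℝ} (hε : 0 < ε) :
    hmBasicSet a b V ε ∈ Filter.generate (hmSubbasis f) :=
  Filter.mem_generate_of_mem ⟨a, b, ha, hab, hb, V, ε, hε, hf, hV, rfl⟩

/-- The sets `N(0,1,V,ε)` with `V` open are open. -/
theorem isOpen_hmBasicSet_zero_one {X : Type u} [TopologicalSpace X] {V : Set X}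
    (hV : IsOpen V) (ε : ℝ) : IsOpen (hmBasicSet 0 1 V ε) := by
  classical
  intro g hg
  obtain ⟨n, a, h0, h1, hm, hc⟩ := id g.2
  set m := volume {t : ℝ | ∃ ht : t ∈ I01, t ∈ Set.Ico (0 : ℝ) 1 ∧ g.1 ⟨t, ht⟩ ∉ V} with hmdef
  have hg' : m < ENNReal.ofReal ε := hg
  have hmtop : m ≠ ⊤ := hg'.ne_top
  have hmε : m.toReal < ε := (ENNReal.lt_ofReal_iff_toReal_lt hmtop).1 hg'
  set δ : ℝ := (ε - m.toReal) / (n + 1) with hδ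
  have hδ0 : 0 < δ := div_pos (sub_pos.2 hmε) (by positivity)
  have hδsum : m + n * ENNReal.ofReal δ < ENNReal.ofReal ε := by
    have hlt : n * δ < ε - m.toReal := by
      have : (n + 1) * δ = ε - m.toReal := by rw [hδ]; field_simp
      linarith
    rw [← ENNReal.ofReal_toReal hmtop, ← ENNReal.ofReal_natCast,
      ← ENNReal.ofReal_mul (by positivity), ← ENNReal.ofReal_add (by positivity) (by positivity)]
    exact (ENNReal.ofReal_lt_ofReal_iff (ENNReal.toReal_nonneg.trans_lt hmε)).2 (by linarith)
  have ha0 (i) : 0 ≤ a i := h0 ▸ hm.monotone (Fin.zero_le i)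
  have ha1 (i) : a i ≤ 1 := h1 ▸ hm.monotone (Fin.le_last i)
  have hlt (i : Fin n) : a i.castSucc < a i.succ := hm Fin.castSucc_lt_succ
  have hmem (i : Fin n) : a i.castSucc ∈ I01 := ⟨ha0 _, (hlt i).trans_le (ha1 _)⟩
  let P (i : Fin n) : Prop := g.1 ⟨a i.castSucc, hmem i⟩ ∈ V
  have hinter : (⋂ i : Fin n, if P i then hmBasicSet (a i.castSucc) (a i.succ) V δ else univ) ∈
      Filter.generate (hmSubbasis g) := by
    refine Filter.iInter_mem.2 fun i => ?_
    split_ifs with hi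
    · exact hmBasicSet_mem_generate g (ha0 _) (hlt i) (ha1 _) (hc i) (hV.mem_nhds hi) hδ0
    · exact Filter.univ_mem
  refine Filter.mem_of_superset hinter fun h hh => ?_
  let B (i : Fin n) : Set ℝ :=
    if P i then {t | ∃ ht : t ∈ I01, t ∈ Set.Ico (a i.castSucc) (a i.succ) ∧ h.1 ⟨t, ht⟩ ∉ V}
    else ∅
  have hB (i : Fin n) : volume (B i) ≤ ENNReal.ofReal δ := by
    have hi := Set.mem_iInter.1 hh i
    by_cases hP : P i
    · simp only [hP, if_true, B] at hi ⊢
      exact le_of_lt hi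
    · simp [B, hP]
  have hsub : {t : ℝ | ∃ ht : t ∈ I01, t ∈ Set.Ico (0 : ℝ) 1 ∧ h.1 ⟨t, ht⟩ ∉ V} ⊆
      {t : ℝ | ∃ ht : t ∈ I01, t ∈ Set.Ico (0 : ℝ) 1 ∧ g.1 ⟨t, ht⟩ ∉ V} ∪ ⋃ i, B i := by
    rintro t ⟨ht, -, hht⟩
    obtain ⟨i, hi⟩ := exists_mem_cell a t (h0 ▸ ht.1) (h1 ▸ ht.2)
    by_cases hP : P i
    · refine Or.inr (Set.mem_iUnion.2 ⟨i, ?_⟩)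
      simp only [B, hP, if_true]
      exact ⟨ht, hi, hht⟩
    · refine Or.inl ⟨ht, ht, fun hgt => hP ?_⟩
      have := hc i ⟨_, hmem i⟩ ⟨t, ht⟩ ⟨le_rfl, hlt i⟩ hi
      simpa only [P, this] using hgt
  calc _ ≤ _ := measure_mono hsub
    _ ≤ m + volume (⋃ i, B i) := measure_union_le _ _
    _ ≤ m + ∑ i, volume (B i) := by gcongr; exact measure_iUnion_fintype_le _ _
    _ ≤ m + ∑ _i : Fin n, ENNReal.ofReal δ := by gcongr with i; exact hB i
    _ = m + n * ENNReal.ofReal δ := by simp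
    _ < _ := hδsum

theorem hmConst_mem_hmBasicSet {X : Type u} {x : X} {V : Set X} (hx : x ∈ V) (a b : ℝ) {ε : ℝ}
    (hε : 0 < ε) : hmConst x ∈ hmBasicSet a b V ε := by
  have hset : {t : ℝ | ∃ ht : t ∈ I01, t ∈ Set.Ico a b ∧ (hmConst x).1 ⟨t, ht⟩ ∉ V} = ∅ :=
    Set.eq_empty_of_forall_notMem fun _ ⟨_, _, h⟩ => h hx
  change volume _ < _
  rw [hset, measure_empty]
  exact ENNReal.ofReal_pos.2 hε

theorem hmConst_mem_hmBasicSet_zero_one_iff {X : Type u} {x : X} {V : Set X} :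
    hmConst x ∈ hmBasicSet 0 1 V 1 ↔ x ∈ V := by
  refine ⟨fun h => ?_, fun h => hmConst_mem_hmBasicSet h 0 1 one_pos⟩
  by_contra hx
  have hset : {t : ℝ | ∃ ht : t ∈ I01, t ∈ Set.Ico (0 : ℝ) 1 ∧ (hmConst x).1 ⟨t, ht⟩ ∉ V} =
      Set.Ico 0 1 := by
    ext t
    exact ⟨fun ⟨ht, _⟩ => ht, fun ht => ⟨ht, ht, hx⟩⟩
  change volume _ < _ at h
  rw [hset, Real.volume_Ico, sub_zero] at h
  exact h.false

/-- A step function with some value in `V` takes values outside `V` on a set of measure less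
than `1`. -/
theorem mem_hmBasicSet_zero_one {X : Type u} (g : HM X) {s : I01} {V : Set X} (hs : g.1 s ∈ V) :
    g ∈ hmBasicSet 0 1 V 1 := by
  obtain ⟨n, a, h0, h1, hm, hc⟩ := id g.2
  obtain ⟨i, hi⟩ := exists_mem_cell a s (h0 ▸ s.2.1) (h1 ▸ s.2.2)
  have ha0 : 0 ≤ a i.castSucc := h0 ▸ hm.monotone (Fin.zero_le _)
  have ha1 : a i.succ ≤ 1 := h1 ▸ hm.monotone (Fin.le_last _)
  have hlt : a i.castSucc < a i.succ := hm Fin.castSucc_lt_succ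
  have hsub : {t : ℝ | ∃ ht : t ∈ I01, t ∈ Set.Ico (0 : ℝ) 1 ∧ g.1 ⟨t, ht⟩ ∉ V} ⊆
      Set.Ico 0 (a i.castSucc) ∪ Set.Ico (a i.succ) 1 := by
    rintro t ⟨ht, -, hgt⟩
    by_contra hcon
    simp only [Set.mem_union, Set.mem_Ico, not_or, not_and, not_lt] at hcon
    have hti : t ∈ Set.Ico (a i.castSucc) (a i.succ) :=
      ⟨hcon.1 ht.1, lt_of_not_ge fun h => (hcon.2 h).not_gt ht.2⟩
    exact hgt (hc i s ⟨t, ht⟩ hi hti ▸ hs)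
  calc _ ≤ _ := measure_mono hsub
    _ ≤ _ := measure_union_le _ _
    _ = ENNReal.ofReal (a i.castSucc + (1 - a i.succ)) := by
      rw [Real.volume_Ico, Real.volume_Ico, sub_zero,
        ← ENNReal.ofReal_add ha0 (sub_nonneg.2 ha1)]
    _ < ENNReal.ofReal 1 := (ENNReal.ofReal_lt_ofReal_iff one_pos).2 (by linarith)

theorem continuous_hmConst (X : Type u) [TopologicalSpace X] :
    Continuous (hmConst : X → HM X) := by
  refine continuous_def.2 fun U hU => isOpen_iff_mem_nhds.2 fun x hx => ?_
  have hle : Filter.map hmConst (𝓝 x) ≤ Filter.generate (hmSubbasis (hmConst x)) := by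
    refine Filter.le_generate_iff.2 ?_
    rintro S ⟨a, b, ha, hab, hb, V, ε, hε, -, hV, rfl⟩
    refine Filter.mem_map.2 (Filter.mem_of_superset hV fun y hy => ?_)
    exact hmConst_mem_hmBasicSet hy a b hε
  exact hle (hU _ hx)

theorem isInducing_hmConst (X : Type u) [TopologicalSpace X] :
    IsInducing (hmConst : X → HM X) := by
  refine ⟨le_antisymm (continuous_hmConst X).le_induced fun V hV => ?_⟩
  exact ⟨hmBasicSet 0 1 V 1, isOpen_hmBasicSet_zero_one hV 1,
    Set.ext fun _ => hmConst_mem_hmBasicSet_zero_one_iff⟩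

theorem hmConst_injective (X : Type u) : Function.Injective (hmConst : X → HM X) := fun _ _ h =>
  congrFun (congrArg Subtype.val h) ⟨0, le_rfl, one_pos⟩

theorem isClosed_range_hmConst (X : Type u) [TopologicalSpace X] [T2Space X] :
    IsClosed (Set.range (hmConst : X → HM X)) := by
  refine ⟨isOpen_iff_forall_mem_open.2 fun g hg => ?_⟩
  obtain ⟨s, hs⟩ : ∃ s, g.1 s ≠ g.1 ⟨0, le_rfl, one_pos⟩ := by
    by_contra! h
    exact hg ⟨_, Subtype.ext (funext fun s => (h s).symm)⟩
  obtain ⟨V, W, hV, hW, hsV, hW0, hVW⟩ := t2_separation hs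
  refine ⟨hmBasicSet 0 1 V 1 ∩ hmBasicSet 0 1 W 1, ?_,
    (isOpen_hmBasicSet_zero_one hV 1).inter (isOpen_hmBasicSet_zero_one hW 1),
    mem_hmBasicSet_zero_one g hsV, mem_hmBasicSet_zero_one g hW0⟩
  rintro _ ⟨hxV, hxW⟩ ⟨x, rfl⟩
  exact Set.disjoint_left.1 hVW (hmConst_mem_hmBasicSet_zero_one_iff.1 hxV)
    (hmConst_mem_hmBasicSet_zero_one_iff.1 hxW)

/-- For a Hausdorff space `X` the canonical map `hm_X : X → HM(X)` is a closed
topological embedding. -/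
theorem isClosedEmbedding_hmConst (X : Type u) [TopologicalSpace X] [T2Space X] :
    Topology.IsClosedEmbedding (hmConst : X → HM X) := by
  exact ⟨⟨isInducing_hmConst X, hmConst_injective X⟩, isClosed_range_hmConst X⟩

end HMPaper
end

section
/- (Proposition 2, first part) Let ℰ = (Eₙ)_{n∈ℕ} be a continuous signature and X a topological ℰ-algebra with operations eₙ : Eₙ × Xⁿ → X. Then HM(X), endowed with the Hartman–Mycielski topology and the pointwise operations eₙ^{HM}(c, f₁, …, fₙ)(t) = eₙ(c, f₁(t), …, fₙ(t)), is a topological ℰ-algebra; in particular, each operation eₙ^{HM} : Eₙ × HM(X)ⁿ → HM(X) is continuous. -/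
open Set MeasureTheory Topology

universe u v

namespace HMPaper

variable {E : ℕ → Type u} [∀ n, TopologicalSpace (E n)]

theorem measure_iUnion_lt_ofReal {ι α : Type*} [Fintype ι] [MeasurableSpace α]
    {μ : Measure α} {s : ι → Set α} {ε : ℝ} (hε : 0 < ε)
    (h : ∀ i, μ (s i) < ENNReal.ofReal (ε / (Fintype.card ι + 1))) :
    μ (⋃ i, s i) < ENNReal.ofReal ε := by
  have hk : (0 : ℝ) ≤ Fintype.card ι := Nat.cast_nonneg _
  calc μ (⋃ i, s i) ≤ ∑ i, μ (s i) := measure_iUnion_fintype_le μ s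
    _ ≤ ∑ _i : ι, ENNReal.ofReal (ε / (Fintype.card ι + 1)) :=
        Finset.sum_le_sum fun i _ => (h i).le
    _ = ENNReal.ofReal (Fintype.card ι * (ε / (Fintype.card ι + 1))) := by
        rw [Finset.sum_const, Finset.card_univ, nsmul_eq_mul, ENNReal.ofReal_mul hk,
          ENNReal.ofReal_natCast]
    _ < ENNReal.ofReal ε := by
        rw [ENNReal.ofReal_lt_ofReal_iff hε, mul_div_assoc', div_lt_iff₀ (by positivity)]
        linarith

theorem IsStep.finite_range {X : Type u} {f : I01 → X} (hf : IsStep f) :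
    (range f).Finite := by
  obtain ⟨n, a, h0, h1, hmono, hconst⟩ := hf
  have hmem (i : Fin n) : a i.castSucc ∈ I01 :=
    ⟨h0 ▸ hmono.monotone (Fin.zero_le _), h1 ▸ hmono (Fin.castSucc_lt_last i)⟩
  refine (Set.finite_range fun i : Fin n => f ⟨a i.castSucc, hmem i⟩).subset ?_
  rintro _ ⟨t, rfl⟩
  obtain ⟨i, hi⟩ := exists_mem_cell a t (h0 ▸ t.2.1) (h1 ▸ t.2.2)
  exact ⟨i, hconst i _ _ ⟨le_rfl, hmono i.castSucc_lt_succ⟩ hi⟩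

/-- Step functions close to `f` take values in a prescribed neighborhood of `f t` for all `t`
outside a set of small measure. -/
theorem eventually_generate_volume_lt {X : Type u} [TopologicalSpace X] (f : HM X)
    {U : X → Set X} (hU : ∀ x ∈ range f.1, U x ∈ 𝓝 x) {ε : ℝ} (hε : 0 < ε) :
    ∀ᶠ g in Filter.generate (hmSubbasis f),
      volume {t : ℝ | ∃ ht : t ∈ I01, g.1 ⟨t, ht⟩ ∉ U (f.1 ⟨t, ht⟩)} < ENNReal.ofReal ε := by
  obtain ⟨n, a, h0, h1, hmono, hconst⟩ := f.2
  have hmem (i : Fin n) : a i.castSucc ∈ I01 :=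
    ⟨h0 ▸ hmono.monotone (Fin.zero_le _), h1 ▸ hmono (Fin.castSucc_lt_last i)⟩
  have hpiece (i : Fin n) : ∀ᶠ g in Filter.generate (hmSubbasis f),
      g ∈ hmBasicSet (a i.castSucc) (a i.succ) (U (f.1 ⟨a i.castSucc, hmem i⟩))
        (ε / (Fintype.card (Fin n) + 1)) :=
    Filter.GenerateSets.basic ⟨_, _, (hmem i).1, hmono i.castSucc_lt_succ,
      h1 ▸ hmono.monotone (Fin.le_last _), _, _, by positivity, hconst i,
      hU _ (mem_range_self _), rfl⟩
  filter_upwards [Filter.eventually_all.2 hpiece] with g hg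
  refine (measure_mono ?_).trans_lt (measure_iUnion_lt_ofReal hε hg)
  rintro t ⟨ht, hgt⟩
  obtain ⟨i, hi⟩ := exists_mem_cell a t (h0 ▸ ht.1) (h1 ▸ ht.2)
  refine mem_iUnion.2 ⟨i, ht, hi, ?_⟩
  rwa [hconst i ⟨a i.castSucc, hmem i⟩ ⟨t, ht⟩ ⟨le_rfl, hmono i.castSucc_lt_succ⟩ hi]

theorem mem_hmBasicSet_self {X : Type u} {f : HM X} {a b : ℝ} {V : Set X} {ε : ℝ}
    (hε : 0 < ε) (h : ∀ t : I01, (t : ℝ) ∈ Ico a b → f.1 t ∈ V) : f ∈ hmBasicSet a b V ε := by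
  have : {t : ℝ | ∃ ht : t ∈ I01, t ∈ Ico a b ∧ f.1 ⟨t, ht⟩ ∉ V} = ∅ :=
    eq_empty_of_forall_notMem fun t ⟨ht, htab, hV⟩ => hV (h ⟨t, ht⟩ htab)
  change volume _ < _
  rw [this, measure_empty]
  exact ENNReal.ofReal_pos.2 hε

theorem eventually_mem_hmBasicSet {X : Type u} [TopologicalSpace X] {a b : ℝ} {V : Set X}
    (hV : IsOpen V) {ε : ℝ} {g : HM X} (hg : g ∈ hmBasicSet a b V ε) :
    ∀ᶠ h in Filter.generate (hmSubbasis g), h ∈ hmBasicSet a b V ε := by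
  classical
  set m := volume {t : ℝ | ∃ ht : t ∈ I01, t ∈ Ico a b ∧ g.1 ⟨t, ht⟩ ∉ V}
  have hm : m < ENNReal.ofReal ε := hg
  have hm_top : m ≠ ⊤ := hm.ne_top
  have hδ : 0 < ε - m.toReal := sub_pos.2 ((ENNReal.lt_ofReal_iff_toReal_lt hm_top).1 hm)
  have hsum : m + ENNReal.ofReal (ε - m.toReal) = ENNReal.ofReal ε := by
    rw [← ENNReal.ofReal_toReal hm_top, ENNReal.toReal_ofReal ENNReal.toReal_nonneg,
      ← ENNReal.ofReal_add ENNReal.toReal_nonneg hδ.le, add_sub_cancel]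
  have hU : ∀ x ∈ range g.1, (if x ∈ V then V else univ) ∈ 𝓝 x := by
    intro x _
    split_ifs with hx
    exacts [hV.mem_nhds hx, Filter.univ_mem]
  filter_upwards [eventually_generate_volume_lt g hU hδ] with h hh
  calc volume {t : ℝ | ∃ ht : t ∈ I01, t ∈ Ico a b ∧ h.1 ⟨t, ht⟩ ∉ V}
      ≤ m + volume {t : ℝ | ∃ ht : t ∈ I01, h.1 ⟨t, ht⟩ ∉
          (if g.1 ⟨t, ht⟩ ∈ V then V else univ)} := by
        refine (measure_mono ?_).trans (measure_union_le _ _)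
        rintro t ⟨ht, htab, hVt⟩
        by_cases hgt : g.1 ⟨t, ht⟩ ∈ V
        · exact Or.inr ⟨ht, by rwa [if_pos hgt]⟩
        · exact Or.inl ⟨ht, htab, hgt⟩
    _ < m + ENNReal.ofReal (ε - m.toReal) := ENNReal.add_lt_add_left hm_top hh
    _ = ENNReal.ofReal ε := hsum

theorem hmBasicSet_mono {X : Type u} {a b : ℝ} {V W : Set X} (h : V ⊆ W) (ε : ℝ) :
    hmBasicSet a b V ε ⊆ hmBasicSet a b W ε := by
  refine fun g hg => (measure_mono ?_).trans_lt hg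
  rintro t ⟨ht, htab, hW⟩
  exact ⟨ht, htab, fun hV => hW (h hV)⟩

theorem nhds_hm {X : Type u} [TopologicalSpace X] (f : HM X) :
    𝓝 f = Filter.generate (hmSubbasis f) := by
  refine TopologicalSpace.nhds_mkOfNhds _ f ?_ ?_
  · intro f
    refine Filter.le_generate_iff.2 ?_
    rintro _ ⟨a, b, ha, hab, hb, V, ε, hε, hconst, hV, rfl⟩
    refine mem_hmBasicSet_self hε fun t ht => ?_
    rw [hconst t ⟨a, ha, hab.trans_le hb⟩ ht ⟨le_rfl, hab⟩]
    exact mem_of_mem_nhds hV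
  · intro f s hs
    suffices (Filter.generate (hmSubbasis f)).bind (fun g => Filter.generate (hmSubbasis g)) ≤
        Filter.generate (hmSubbasis f) from Filter.mem_bind'.1 (this hs)
    refine Filter.le_generate_iff.2 ?_
    rintro _ ⟨a, b, ha, hab, hb, V, ε, hε, hconst, hV, rfl⟩
    refine Filter.mem_bind'.2 ?_
    have hint : hmBasicSet a b (interior V) ε ∈ Filter.generate (hmSubbasis f) :=
      Filter.GenerateSets.basic
        ⟨a, b, ha, hab, hb, _, ε, hε, hconst, interior_mem_nhds.2 hV, rfl⟩
    filter_upwards [hint] with g hg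
    exact Filter.mem_of_superset (eventually_mem_hmBasicSet isOpen_interior hg)
      (hmBasicSet_mono interior_subset ε)

/-- (Proposition 2, first part) If `X` is a topological `ℰ`-algebra then `HM(X)`, with
the Hartman–Mycielski topology and the pointwise operations
`eₙ^{HM}(c, f₁, …, fₙ)(t) = eₙ(c, f₁(t), …, fₙ(t))`, is a topological `ℰ`-algebra:
each operation `eₙ^{HM} : Eₙ × HM(X)ⁿ → HM(X)` is continuous. -/
theorem continuous_hmOps {E : ℕ → Type u} [∀ n, TopologicalSpace (E n)]
    (X : Type u) [TopologicalSpace X] (e : ∀ n : ℕ, E n × (Fin n → X) → X)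
    (he : ∀ n, Continuous (e n)) :
    ∀ n : ℕ, Continuous (hmOps e n : E n × (Fin n → HM X) → HM X) := by
  intro n
  refine continuous_iff_continuousAt.2 fun ⟨c, f⟩ => ?_
  rw [ContinuousAt, nhds_hm, Filter.Tendsto, Filter.le_generate_iff]
  rintro _ ⟨a, b, ha, hab, hb, V, ε, hε, hconst, hV, rfl⟩
  set y := (hmOps e n (c, f)).1 ⟨a, ha, hab.trans_le hb⟩
  have hbox (v : Fin n → X) : ∃ W ∈ 𝓝 c, ∃ U : Fin n → Set X, (∀ i, U i ∈ 𝓝 (v i)) ∧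
      (e n (c, v) = y → ∀ c' ∈ W, ∀ w, (∀ i, w i ∈ U i) → e n (c', w) ∈ V) := by
    by_cases hv : e n (c, v) = y
    · have hpre : e n ⁻¹' V ∈ 𝓝 (c, v) := (he n).continuousAt (hv ▸ hV)
      obtain ⟨W, hW, P, hP, hWP⟩ := mem_nhds_prod_iff.1 hpre
      rw [nhds_pi, Filter.mem_pi'] at hP
      obtain ⟨I, U, hU, hUP⟩ := hP
      exact ⟨W, hW, U, hU, fun _ c' hc' w hw => hWP ⟨hc', hUP fun i _ => hw i⟩⟩
    · exact ⟨univ, Filter.univ_mem, fun _ => univ, fun _ => Filter.univ_mem, fun h => (hv h).elim⟩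
  choose W hW U hU hWU using hbox
  have hfin : (univ.pi fun i => range (f i).1).Finite :=
    Finite.pi fun i => (f i).2.finite_range
  have hc : ∀ᶠ p in 𝓝 (c, f), p.1 ∈ ⋂ v ∈ univ.pi fun i => range (f i).1, W v :=
    continuous_fst.continuousAt ((Filter.biInter_mem hfin).2 fun v _ => hW v)
  have hg (i : Fin n) : ∀ᶠ p in 𝓝 (c, f), volume {t : ℝ | ∃ ht : t ∈ I01,
      (p.2 i).1 ⟨t, ht⟩ ∉ ⋂ v ∈ {v ∈ univ.pi fun j => range (f j).1 | v i = (f i).1 ⟨t, ht⟩},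
        U v i} < ENNReal.ofReal (ε / (Fintype.card (Fin n) + 1)) := by
    have hnhds := eventually_generate_volume_lt (f i)
      (U := fun x => ⋂ v ∈ {v ∈ univ.pi fun j => range (f j).1 | v i = x}, U v i)
      (fun x _ => (Filter.biInter_mem (hfin.subset (sep_subset _ _))).2
        fun v hv => hv.2 ▸ hU v i)
      (ε := ε / (Fintype.card (Fin n) + 1)) (by positivity)
    rw [← nhds_hm] at hnhds
    have hproj : Continuous fun p : E n × (Fin n → HM X) => p.2 i :=
      (continuous_apply i).comp continuous_snd
    exact (hproj.tendsto (c, f)).eventually hnhds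
  change ∀ᶠ p in 𝓝 (c, f), hmOps e n p ∈ hmBasicSet a b V ε
  filter_upwards [hc, Filter.eventually_all.2 hg] with p hpc hpg
  refine (measure_mono ?_).trans_lt (measure_iUnion_lt_ofReal hε hpg)
  rintro t ⟨ht, htab, hVt⟩
  by_contra hgood
  simp only [mem_iUnion, mem_ofPred_eq, not_exists, not_not] at hgood
  have hmem : (fun i => (f i).1 ⟨t, ht⟩) ∈ univ.pi fun i => range (f i).1 :=
    fun i _ => mem_range_self _
  exact hVt (hWU _ (hconst ⟨t, ht⟩ ⟨a, ha, hab.trans_le hb⟩ htab ⟨le_rfl, hab⟩) _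
    (mem_iInter₂.1 hpc _ hmem) _ fun i => mem_iInter₂.1 (hgood i ht) _ ⟨hmem, rfl⟩)

end HMPaper
end
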